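/- arXiv:0706.3608 — 2 statements merged into one kernel-verified Lean document; each statement's English description precedes it below -/
import Mathlib

section
/- The function (℘'(u) + ℘'(u₀))/(2(℘(u) - ℘(u₀))) equals ζ(u - u₀) - ζ(u) + ζ(u₀), where ℘ and ζ are the Weierstrass functions of the lattice Λ, for all u where both sides are defined. -/
open Complex

/-- Membership in the lattice `Λ = ℤω₁ + ℤω₂`. -/
def IsLatticePt (ω₁ ω₂ z : ℂ) : Prop := ∃ m n : ℤ, z = (m : ℂ) * ω₁ + (n : ℂ) * ω₂

/-- The Weierstrass `℘`-function of the lattice `Λ = ℤω₁ + ℤω₂`. -/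
noncomputable def wp (ω₁ ω₂ z : ℂ) : ℂ :=
  1 / z ^ 2 + ∑' p : {q : ℤ × ℤ // q ≠ 0},
    (1 / (z - ((p.1.1 : ℂ) * ω₁ + (p.1.2 : ℂ) * ω₂)) ^ 2
      - 1 / ((p.1.1 : ℂ) * ω₁ + (p.1.2 : ℂ) * ω₂) ^ 2)

/-- The Weierstrass zeta function of the lattice `Λ = ℤω₁ + ℤω₂`. -/
noncomputable def wzeta (ω₁ ω₂ z : ℂ) : ℂ :=
  1 / z + ∑' p : {q : ℤ × ℤ // q ≠ 0},
    (1 / (z - ((p.1.1 : ℂ) * ω₁ + (p.1.2 : ℂ) * ω₂))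
      + 1 / ((p.1.1 : ℂ) * ω₁ + (p.1.2 : ℂ) * ω₂)
      + z / ((p.1.1 : ℂ) * ω₁ + (p.1.2 : ℂ) * ω₂) ^ 2)

/-- The Weierstrass sigma function of the lattice `Λ = ℤω₁ + ℤω₂`. -/
noncomputable def wsigma (ω₁ ω₂ z : ℂ) : ℂ :=
  z * ∏' p : {q : ℤ × ℤ // q ≠ 0},
    ((1 - z / ((p.1.1 : ℂ) * ω₁ + (p.1.2 : ℂ) * ω₂)) *
      Complex.exp (z / ((p.1.1 : ℂ) * ω₁ + (p.1.2 : ℂ) * ω₂)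
        + z ^ 2 / (2 * ((p.1.1 : ℂ) * ω₁ + (p.1.2 : ℂ) * ω₂) ^ 2)))

open Filter Topology

/-- Weierstrass zeta series with the term `l₀` omitted. -/
noncomputable def zetaEx (L : PeriodPair) (l₀ z : ℂ) : ℂ :=
  ∑' l : L.lattice, if l.1 = l₀ then 0 else (1 / (z - l) + 1 / l + z / l ^ 2)

lemma zeta_bound (r : ℝ) (hr : 0 < r) (s : ℂ) (hs : ‖s‖ < r) (l : ℂ) (h : 2 * r ≤ ‖l‖) :
    ‖1 / (s - l) + 1 / l + s / l ^ 2‖ ≤ 2 * r ^ 2 * ‖l‖ ^ (-3 : ℝ) := by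
  have h1 : s - l ≠ 0 := by
    intro e
    rw [sub_eq_zero] at e
    subst e
    linarith
  have h2 : 0 < ‖l‖ := by linarith
  have h3 : l ≠ 0 := norm_pos_iff.mp h2
  have h4 : ‖l‖ / 2 ≤ ‖s - l‖ := by
    rw [norm_sub_rev]
    exact .trans (by linarith) (norm_sub_norm_le l s)
  have e : 1 / (s - l) + 1 / l + s / l ^ 2 = s ^ 2 / ((s - l) * l ^ 2) := by
    field_simp
    ring
  calc
    _ = ‖s‖ ^ 2 / (‖s - l‖ * ‖l‖ ^ 2) := by rw [e]; simp
    _ ≤ r ^ 2 / (‖l‖ / 2 * ‖l‖ ^ 2) := by gcongr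
    _ = 2 * r ^ 2 / ‖l‖ ^ 3 := by field_simp
    _ = _ := by norm_cast

lemma hasSumLU_zetaEx (L : PeriodPair) (l₀ : ℂ) :
    HasSumLocallyUniformly
      (fun (l : L.lattice) (z : ℂ) ↦ if l.1 = l₀ then 0 else (1 / (z - l) + 1 / l + z / l ^ 2))
      (zetaEx L l₀) := by
  refine L.hasSumLocallyUniformly_aux (u := fun r l ↦ 2 * r ^ 2 * ‖l‖ ^ (-3 : ℝ)) _
    (fun _ _ ↦ (ZLattice.summable_norm_rpow _ _ (by simp; norm_num)).mul_left _) fun r hr ↦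
    Filter.eventually_atTop.mpr ⟨2 * r, ?_⟩
  rintro _ h s hs l rfl
  split_ifs
  · rw [norm_zero]; positivity
  · exact zeta_bound r hr s hs l h

lemma zeta_term_hasDerivAt (l z : ℂ) (h : z - l ≠ 0) :
    HasDerivAt (fun z ↦ 1 / (z - l) + 1 / l + z / l ^ 2) (-(1 / (z - l) ^ 2 - 1 / l ^ 2)) z := by
  have h1 : HasDerivAt (fun z ↦ z - l) 1 z := (hasDerivAt_id z).sub_const l
  have h2 := ((h1.inv h).add_const (1 / l)).add ((hasDerivAt_id z).div_const (l ^ 2))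
  have e1 : (fun z ↦ 1 / (z - l) + 1 / l + z / l ^ 2) =
      (fun x ↦ (fun z ↦ z - l)⁻¹ x + 1 / l) + fun x ↦ id x / l ^ 2 := by
    ext w; simp
  have e2 : -(1 / (z - l) ^ 2 - 1 / l ^ 2) = -1 / (z - l) ^ 2 + 1 / l ^ 2 := by ring
  rw [e1, e2]
  exact h2

lemma zetaEx_hasDerivAt (L : PeriodPair) (l₀ z : ℂ) (hz : z ∈ ((L.lattice : Set ℂ) \ {l₀})ᶜ) :
    HasDerivAt (zetaEx L l₀) (-L.weierstrassPExcept l₀ z) z := by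
  have hterm : ∀ l : L.lattice, ∀ w ∈ ((L.lattice : Set ℂ) \ {l₀})ᶜ,
      HasDerivAt (fun z ↦ if l.1 = l₀ then 0 else (1 / (z - l.1) + 1 / l.1 + z / l.1 ^ 2))
        (-(if l.1 = l₀ then 0 else (1 / (w - l.1) ^ 2 - 1 / l.1 ^ 2))) w := by
    intro l w hw
    split_ifs with h
    · simpa using hasDerivAt_const w (0 : ℂ)
    · refine zeta_term_hasDerivAt _ _ fun e ↦ h ?_
      obtain rfl := sub_eq_zero.mp e
      simpa using hw
  have hd : DifferentiableOn ℂ (zetaEx L l₀) ((L.lattice : Set ℂ) \ {l₀})ᶜ := by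
    refine (hasSumLU_zetaEx L l₀).hasSumLocallyUniformlyOn.differentiableOn
      (.of_forall fun s ↦ .fun_sum fun i hi ↦ ?_) L.isOpen_compl_lattice_sdiff
    exact fun w hw ↦ (hterm i w hw).differentiableAt.differentiableWithinAt
  have hE : Set.EqOn (deriv (zetaEx L l₀)) (fun w ↦ -L.weierstrassPExcept l₀ w)
      ((L.lattice : Set ℂ) \ {l₀})ᶜ := by
    intro w hw
    have h1 := ((hasSumLU_zetaEx L l₀).tendstoLocallyUniformlyOn
      (s := ((L.lattice : Set ℂ) \ {l₀})ᶜ)).deriv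
      (.of_forall fun s ↦ .fun_sum fun i hi ↦ fun w hw ↦
        (hterm i w hw).differentiableAt.differentiableWithinAt) L.isOpen_compl_lattice_sdiff
    have h2 := h1.tendsto_at hw
    refine tendsto_nhds_unique h2 ?_
    have h3 := (L.hasSum_weierstrassPExcept l₀ w).neg
    refine Tendsto.congr (fun s ↦ ?_) h3
    exact ((HasDerivAt.fun_sum fun i _ ↦ hterm i w hw).deriv).symm
  have hEz : deriv (zetaEx L l₀) z = -L.weierstrassPExcept l₀ z := hE hz
  rw [← hEz]
  exact (hd.differentiableAt (L.isOpen_compl_lattice_sdiff.mem_nhds hz)).hasDerivAt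

lemma zetaEx_zero (L : PeriodPair) (l₀ : ℂ) : zetaEx L l₀ 0 = 0 := by
  simp [zetaEx]

/-- Weierstrass zeta over a `PeriodPair`. -/
noncomputable def zetaL (L : PeriodPair) (z : ℂ) : ℂ := zetaEx L (L.ω₁ / 2) z

lemma zetaL_eq (L : PeriodPair) (z : ℂ) : zetaL L z = 1 / z + zetaEx L 0 z := by
  have h1 := (hasSumLU_zetaEx L 0).hasSum (x := z)
  have h2 : HasSum (fun l : L.lattice ↦ if l = 0 then 1 / z else 0) (1 / z) := hasSum_ite_eq 0 _
  have h3 : HasSum (fun l : L.lattice ↦ if l.1 = L.ω₁ / 2 then 0 else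
      (1 / (z - l) + 1 / l + z / l ^ 2)) (zetaL L z) :=
    (hasSumLU_zetaEx L (L.ω₁ / 2)).hasSum
  refine h3.unique ?_
  convert h2.add h1 using 2 with l
  have : l.1 ≠ L.ω₁ / 2 := fun e ↦ L.ω₁_div_two_notMem_lattice (e ▸ l.2)
  by_cases hl : l = 0
  · subst hl
    have h0 : ¬ (0 = L.ω₁ / 2) := by simpa using this
    simp [h0]
  · have : l.1 ≠ 0 := by simpa using hl
    simp_all

lemma zetaL_hasDerivAt (L : PeriodPair) (z : ℂ) (hz : z ∉ L.lattice) :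
    HasDerivAt (zetaL L) (-L.weierstrassP z) z := by
  rw [← L.weierstrassPExcept_of_notMem _ L.ω₁_div_two_notMem_lattice]
  exact zetaEx_hasDerivAt L _ z (by simp [hz])

lemma zetaL_add (L : PeriodPair) (l : L.lattice) : ∃ η : ℂ, ∀ z, z ∉ L.lattice →
    zetaL L (z + l) = zetaL L z + η := by
  have hsub : ∀ z : ℂ, z ∉ L.lattice → z + l ∉ L.lattice := fun z hz h ↦
    hz (by simpa using sub_mem h l.2)
  have hd : ∀ z ∈ (L.lattice : Set ℂ)ᶜ, HasDerivAt (fun z ↦ zetaL L (z + l) - zetaL L z) 0 z := by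
    intro z hz
    have h1 := (zetaL_hasDerivAt L (z + l) (hsub z hz)).comp_add_const z l.1
    have h2 := h1.sub (zetaL_hasDerivAt L z hz)
    rw [L.weierstrassP_add_coe, sub_self] at h2
    exact h2
  have hc : IsPreconnected (L.lattice : Set ℂ)ᶜ := by
    refine (Set.Countable.isConnected_compl_of_one_lt_rank (by simp) ?_).2
    exact countable_of_Lindelof_of_discrete (X := L.lattice)
  have hw := L.ω₁_div_two_notMem_lattice
  refine ⟨zetaL L (L.ω₁ / 2 + l) - zetaL L (L.ω₁ / 2), fun z hz ↦ ?_⟩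
  have := L.isClosed_lattice.isOpen_compl.is_const_of_deriv_eq_zero (𝕜 := ℂ) hc
    (fun z hz ↦ (hd z hz).differentiableAt.differentiableWithinAt)
    (fun z hz ↦ (hd z hz).deriv) hz hw
  linear_combination this

lemma wp_eq (L : PeriodPair) (z : ℂ) : wp L.ω₁ L.ω₂ z = L.weierstrassP z := by
  rw [← L.weierstrassPExcept_add 0, wp, PeriodPair.weierstrassPExcept,
    ← L.latticeEquivProd.symm.toEquiv.tsum_eq]
  have := tsum_subtype {q : ℤ × ℤ | q ≠ 0} fun p ↦
    (1 / (z - ((p.1 : ℂ) * L.ω₁ + (p.2 : ℂ) * L.ω₂)) ^ 2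
      - 1 / ((p.1 : ℂ) * L.ω₁ + (p.2 : ℂ) * L.ω₂) ^ 2)
  rw [add_comm]
  congr 1
  · refine this.trans (tsum_congr fun q ↦ ?_)
    by_cases hq : q = 0
    · simp [hq]
    · have : (L.latticeEquivProd.symm q) ≠ 0 := by simpa using hq
      simp [hq, L.latticeEquiv_symm_apply] at this ⊢
      simp [← L.latticeEquiv_symm_apply, hq]
  · simp

lemma wzeta_eq (L : PeriodPair) (z : ℂ) : wzeta L.ω₁ L.ω₂ z = zetaL L z := by
  rw [zetaL_eq, wzeta, zetaEx, ← L.latticeEquivProd.symm.toEquiv.tsum_eq]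
  have := tsum_subtype {q : ℤ × ℤ | q ≠ 0} fun p ↦
    (1 / (z - ((p.1 : ℂ) * L.ω₁ + (p.2 : ℂ) * L.ω₂))
      + 1 / ((p.1 : ℂ) * L.ω₁ + (p.2 : ℂ) * L.ω₂)
      + z / ((p.1 : ℂ) * L.ω₁ + (p.2 : ℂ) * L.ω₂) ^ 2)
  congr 1
  refine this.trans (tsum_congr fun q ↦ ?_)
  by_cases hq : q = 0
  · simp [hq]
  · have : (L.latticeEquivProd.symm q) ≠ 0 := by simpa using hq
    simp [hq, L.latticeEquiv_symm_apply] at this ⊢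
    simp [← L.latticeEquiv_symm_apply, hq]

lemma exists_pair (ω₁ ω₂ : ℂ) (h : 0 < (ω₂ / ω₁).im) :
    ∃ L : PeriodPair, L.ω₁ = ω₁ ∧ L.ω₂ = ω₂ := by
  have h0 : ω₁ ≠ 0 := by rintro rfl; simp at h
  refine ⟨⟨ω₁, ω₂, LinearIndependent.pair_iff.mpr fun s t e ↦ ?_⟩, rfl, rfl⟩
  have e2 : (s : ℂ) + t * (ω₂ / ω₁) = 0 := by
    have e' : (s : ℂ) * ω₁ + t * ω₂ = 0 := by simpa using e
    field_simp
    linear_combination e'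
  have him : t * (ω₂ / ω₁).im = 0 := by simpa using congrArg Complex.im e2
  have ht : t = 0 := by
    rcases mul_eq_zero.mp him with h' | h'
    · exact h'
    · exact absurd h' h.ne'
  subst ht
  exact ⟨by simpa using e2, rfl⟩

lemma isLatticePt_iff (L : PeriodPair) (z : ℂ) : IsLatticePt L.ω₁ L.ω₂ z ↔ z ∈ L.lattice := by
  rw [PeriodPair.mem_lattice, IsLatticePt]
  simp only [eq_comm]

lemma tendsto_quad (B b : ℂ → ℂ) (β : ℂ) (hB : ∀ᶠ u in 𝓝 0, HasDerivAt B (b u) u)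
    (hB0 : B 0 = 0) (hb0 : b 0 = 0) (hb : HasDerivAt b β 0) :
    Tendsto (fun u ↦ B u / u ^ 2) (𝓝[≠] 0) (𝓝 (β / 2)) := by
  rw [Metric.tendsto_nhds]
  intro ε hε
  have h1 : ∀ᶠ u in 𝓝 (0 : ℂ), ‖b u - β * u‖ ≤ ε / 2 * ‖u‖ := by
    have := (hasDerivAt_iff_isLittleO.mp hb).def (half_pos hε)
    filter_upwards [this] with u hu
    simpa [hb0, mul_comm] using hu
  obtain ⟨δ, hδ, hball⟩ := Metric.eventually_nhds_iff_ball.mp (hB.and h1)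
  have : ∀ᶠ u in 𝓝[≠] (0 : ℂ), u ∈ Metric.ball 0 δ :=
    nhdsWithin_le_nhds (Metric.ball_mem_nhds _ hδ)
  filter_upwards [this, self_mem_nhdsWithin] with u hu hu0
  have hu0 : u ≠ 0 := hu0
  have hpos : 0 < ‖u‖ := norm_pos_iff.mpr hu0
  have hud : ‖u‖ < δ := by simpa using hu
  have key := (convex_closedBall (0 : ℂ) ‖u‖).norm_image_sub_le_of_norm_hasDerivWithin_le
    (f := fun w ↦ B w - β / 2 * w ^ 2) (f' := fun w ↦ b w - β * w) (C := ε / 2 * ‖u‖)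
    (x := 0) (y := u) ?_ ?_ (by simp) (by simp)
  · have e : B u / u ^ 2 - β / 2 = (B u - β / 2 * u ^ 2) / u ^ 2 := by field_simp
    rw [dist_eq_norm, e, norm_div, norm_pow, div_lt_iff₀ (by positivity)]
    simp only [hB0, sub_zero, ne_eq, OfNat.ofNat_ne_zero, not_false_eq_true, zero_pow, mul_zero]
      at key
    nlinarith [mul_pos hε (pow_pos hpos 2)]
  · intro w hw
    have hw' : ‖w‖ ≤ ‖u‖ := by simpa using hw
    have h2 := (hball w (by simpa using hw'.trans_lt hud)).1
    have h3 := h2.sub (((hasDerivAt_pow 2 w)).const_mul (β / 2))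
    refine (h3.congr_deriv ?_).hasDerivWithinAt
    simp
    ring
  · intro w hw
    have hw' : ‖w‖ ≤ ‖u‖ := by simpa using hw
    refine (hball w (by simpa using hw'.trans_lt hud)).2.trans ?_
    gcongr

/-- The difference of the two sides, after clearing denominators. -/
noncomputable def rawD (L : PeriodPair) (v u : ℂ) : ℂ :=
  2 * (L.weierstrassP u - L.weierstrassP v) * (zetaL L (u + v) - zetaL L u - zetaL L v)
    - (L.derivWeierstrassP u - L.derivWeierstrassP v)

lemma weierstrassP_hasDerivAt (L : PeriodPair) (z : ℂ) (hz : z ∉ L.lattice) :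
    HasDerivAt L.weierstrassP (L.derivWeierstrassP z) z := by
  rw [← L.deriv_weierstrassP]
  exact (L.analyticOnNhd_weierstrassP z hz).differentiableAt.hasDerivAt

lemma ev_notMem (L : PeriodPair) (c : ℂ) : ∀ᶠ z in 𝓝[≠] c, z ∉ L.lattice := by
  filter_upwards [nhdsWithin_le_nhds (L.compl_lattice_sdiff_singleton_mem_nhds c),
    self_mem_nhdsWithin] with z hz hzc h
  exact hz ⟨h, hzc⟩

lemma rawD_tendsto_zero (L : PeriodPair) (v : ℂ) (hv : v ∉ L.lattice) :
    Tendsto (rawD L v) (𝓝[≠] 0) (𝓝 0) := by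
  have hP0 : HasDerivAt (L.weierstrassPExcept 0) 0 0 := by
    have h := (L.analyticAt_weierstrassPExcept 0).differentiableAt.hasDerivAt
    have h' : deriv (L.weierstrassPExcept 0) 0 = 0 := by
      have := L.eqOn_deriv_weierstrassPExcept_derivWeierstrassPExcept 0 (x := 0) (by simp)
      rw [this]
      simp
    rwa [h'] at h
  have hP'0 : L.derivWeierstrassPExcept 0 0 = 0 := by
    simp
  have hP'c : ContinuousAt (L.derivWeierstrassPExcept 0) 0 :=
    (L.analyticAt_derivWeierstrassPExcept 0).continuousAt
  set c := L.weierstrassP v with hc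
  set B : ℂ → ℂ := fun u ↦ zetaL L (u + v) - zetaL L v - zetaEx L 0 u + c * u with hBdef
  set b : ℂ → ℂ := fun u ↦ -L.weierstrassP (u + v) + L.weierstrassPExcept 0 u + c with hbdef
  have hnear : ∀ᶠ u in 𝓝 (0 : ℂ), u + v ∉ L.lattice := by
    have h1 : ContinuousAt (fun u : ℂ ↦ u + v) 0 := by fun_prop
    exact h1.eventually (L.isClosed_lattice.isOpen_compl.mem_nhds (by simpa using hv))
  have hB : ∀ᶠ u in 𝓝 0, HasDerivAt B (b u) u := by
    filter_upwards [hnear, L.compl_lattice_sdiff_singleton_mem_nhds 0] with u hu1 hu2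
    have h1 := (zetaL_hasDerivAt L (u + v) hu1).comp_add_const u v
    have h2 := zetaEx_hasDerivAt L 0 u hu2
    have h3 := (((h1.sub_const (zetaL L v)).sub h2).add ((hasDerivAt_id u).const_mul c))
    refine h3.congr_deriv ?_
    simp only [hbdef]
    ring
  have hB0 : B 0 = 0 := by simp [hBdef, zetaEx_zero]
  have hb0 : b 0 = 0 := by simp [hbdef, hc]
  have hb : HasDerivAt b (-L.derivWeierstrassP v) 0 := by
    have h1 : HasDerivAt (fun u ↦ L.weierstrassP (u + v)) (L.derivWeierstrassP v) 0 :=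
      HasDerivAt.comp_add_const 0 v (by simpa using weierstrassP_hasDerivAt L v hv)
    refine ((h1.neg.add hP0).add_const c).congr_deriv ?_
    ring
  have hq := tendsto_quad B b _ hB hB0 hb0 hb
  have hPu : Tendsto (fun u ↦ L.weierstrassPExcept 0 u / u) (𝓝[≠] 0) (𝓝 0) := by
    have := hasDerivAt_iff_tendsto_slope_zero.mp hP0
    refine this.congr fun u ↦ ?_
    simp [div_eq_inv_mul]
  have hBc : Tendsto B (𝓝[≠] 0) (𝓝 0) := by
    have := hB.self_of_nhds.continuousAt.tendsto
    rw [hB0] at this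
    exact this.mono_left nhdsWithin_le_nhds
  have hPc : Tendsto (L.weierstrassPExcept 0) (𝓝[≠] 0) (𝓝 0) := by
    have := hP0.continuousAt.tendsto
    rw [L.weierstrassPExcept_zero] at this
    exact this.mono_left nhdsWithin_le_nhds
  have hP'c : Tendsto (L.derivWeierstrassPExcept 0) (𝓝[≠] 0) (𝓝 0) := by
    have := hP'c.tendsto
    rw [hP'0] at this
    exact this.mono_left nhdsWithin_le_nhds
  have hid : Tendsto (fun u : ℂ ↦ u) (𝓝[≠] 0) (𝓝 0) :=
    tendsto_id.mono_left nhdsWithin_le_nhds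
  have htot := ((((hq.const_mul 2).sub (hPu.const_mul 2)).add
    (((hPc.sub_const c).mul (hBc.sub (hid.const_mul c))).const_mul 2)).sub hP'c).add_const
    (L.derivWeierstrassP v)
  have e0 : 2 * (-L.derivWeierstrassP v / 2) - 2 * 0 + 2 * ((0 - c) * (0 - c * 0)) - 0
      + L.derivWeierstrassP v = 0 := by ring
  rw [e0] at htot
  refine htot.congr' ?_
  filter_upwards [self_mem_nhdsWithin] with u hu
  have hu : u ≠ 0 := hu
  have e1 := L.weierstrassPExcept_add 0 u
  have e2 := L.derivWeierstrassPExcept_sub 0 u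
  have e3 := zetaL_eq L u
  simp only [ZeroMemClass.coe_zero, sub_zero] at e1 e2
  simp only [rawD, hBdef]
  rw [← e1, ← e2, e3, ← hc]
  field_simp
  ring

lemma rawD_tendsto_neg (L : PeriodPair) (v : ℂ) (hv : v ∉ L.lattice) :
    Tendsto (rawD L v) (𝓝[≠] (-v)) (𝓝 0) := by
  have hv' : -v ∉ L.lattice := by simpa using hv
  have hs := (hasDerivAt_iff_tendsto_slope.mp (weierstrassP_hasDerivAt L (-v) hv'))
  have hP : Tendsto L.weierstrassP (𝓝[≠] (-v)) (𝓝 (L.weierstrassP v)) := by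
    have := (weierstrassP_hasDerivAt L (-v) hv').continuousAt.tendsto
    rw [L.weierstrassP_neg] at this
    exact this.mono_left nhdsWithin_le_nhds
  have hP' : Tendsto L.derivWeierstrassP (𝓝[≠] (-v)) (𝓝 (-L.derivWeierstrassP v)) := by
    have := (L.analyticOnNhd_derivWeierstrassP (-v) hv').continuousAt.tendsto
    rw [L.derivWeierstrassP_neg] at this
    exact this.mono_left nhdsWithin_le_nhds
  have hz : Tendsto (zetaL L) (𝓝[≠] (-v)) (𝓝 (zetaL L (-v))) :=
    (zetaL_hasDerivAt L (-v) hv').continuousAt.tendsto.mono_left nhdsWithin_le_nhds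
  have hZ : Tendsto (fun u ↦ zetaEx L 0 (u + v)) (𝓝[≠] (-v)) (𝓝 0) := by
    have h1 : ContinuousAt (zetaEx L 0) (-v + v) := by
      rw [neg_add_cancel]
      exact (zetaEx_hasDerivAt L 0 0 (by simp)).continuousAt
    have h2 : ContinuousAt (fun u ↦ zetaEx L 0 (u + v)) (-v) :=
      ContinuousAt.comp (f := fun u ↦ u + v) h1 (by fun_prop)
    have := h2.tendsto
    rw [neg_add_cancel, zetaEx_zero] at this
    exact this.mono_left nhdsWithin_le_nhds
  have htot := ((hs.const_mul 2).add (((hP.sub_const (L.weierstrassP v)).mul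
    ((hZ.sub hz).sub_const (zetaL L v))).const_mul 2)).sub (hP'.sub_const (L.derivWeierstrassP v))
  have e0 : 2 * L.derivWeierstrassP (-v) + 2 * ((L.weierstrassP v - L.weierstrassP v) *
      (0 - zetaL L (-v) - zetaL L v)) - (-L.derivWeierstrassP v - L.derivWeierstrassP v) = 0 := by
    rw [L.derivWeierstrassP_neg]; ring
  rw [e0] at htot
  refine htot.congr' ?_
  filter_upwards [self_mem_nhdsWithin] with u hu
  have hu : u + v ≠ 0 := fun h ↦ hu (eq_neg_of_add_eq_zero_left h)
  simp only [rawD, zetaL_eq L (u + v), slope_def_field, L.weierstrassP_neg, sub_neg_eq_add]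
  field_simp
  ring

open Classical in
/-- `rawD` extended by zero. -/
noncomputable def extD (L : PeriodPair) (v u : ℂ) : ℂ :=
  if u ∈ L.lattice ∨ u + v ∈ L.lattice then 0 else rawD L v u

lemma mem_add_coe (L : PeriodPair) (u : ℂ) (l : L.lattice) :
    u + l ∈ L.lattice ↔ u ∈ L.lattice :=
  ⟨fun h ↦ by simpa using sub_mem h l.2, fun h ↦ add_mem h l.2⟩

lemma extD_add (L : PeriodPair) (v u : ℂ) (l : L.lattice) : extD L v (u + l) = extD L v u := by
  obtain ⟨η, hη⟩ := zetaL_add L l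
  have e : u + l + v = u + v + l := by ring
  by_cases h : u ∈ L.lattice ∨ u + v ∈ L.lattice
  · have h' : u + l ∈ L.lattice ∨ u + l + v ∈ L.lattice := by
      rwa [e, mem_add_coe, mem_add_coe]
    rw [extD, extD, if_pos h, if_pos h']
  · have h' : ¬ (u + l ∈ L.lattice ∨ u + l + v ∈ L.lattice) := by
      rwa [e, mem_add_coe, mem_add_coe]
    rw [extD, extD, if_neg h, if_neg h']
    rw [not_or] at h
    simp only [rawD, e, hη _ h.1, hη _ h.2, L.weierstrassP_add_coe, L.derivWeierstrassP_add_coe]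
    ring

lemma rawD_diff (L : PeriodPair) (v u : ℂ) (h1 : u ∉ L.lattice) (h2 : u + v ∉ L.lattice) :
    DifferentiableAt ℂ (rawD L v) u := by
  have a1 := (weierstrassP_hasDerivAt L u h1).differentiableAt
  have a2 := (L.analyticOnNhd_derivWeierstrassP u h1).differentiableAt
  have a3 := (zetaL_hasDerivAt L u h1).differentiableAt
  have a4 := ((zetaL_hasDerivAt L (u + v) h2).comp_add_const u v).differentiableAt
  unfold rawD
  fun_prop

lemma extD_diff_off (L : PeriodPair) (v u : ℂ) (h1 : u ∉ L.lattice) (h2 : u + v ∉ L.lattice) :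
    DifferentiableAt ℂ (extD L v) u := by
  refine (rawD_diff L v u h1 h2).congr_of_eventuallyEq ?_
  have c1 : ContinuousAt (fun u : ℂ ↦ u + v) u := by fun_prop
  filter_upwards [L.isClosed_lattice.isOpen_compl.mem_nhds h1,
    c1.eventually (L.isClosed_lattice.isOpen_compl.mem_nhds h2)] with w hw1 hw2
  exact if_neg (not_or.mpr ⟨hw1, hw2⟩)

lemma extD_diff_of_tendsto (L : PeriodPair) (v c : ℂ) (hc : c ∈ L.lattice ∨ c + v ∈ L.lattice)
    (ht : Tendsto (rawD L v) (𝓝[≠] c) (𝓝 0)) : DifferentiableAt ℂ (extD L v) c := by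
  have hc0 : extD L v c = 0 := if_pos hc
  refine (Complex.analyticAt_of_differentiable_on_punctured_nhds_of_continuousAt
    ?_ ?_).differentiableAt
  · have h2 : Tendsto (fun u : ℂ ↦ u + v) (𝓝[≠] c) (𝓝[≠] (c + v)) := by
      refine tendsto_nhdsWithin_iff.mpr ⟨?_, ?_⟩
      · have : ContinuousAt (fun u : ℂ ↦ u + v) c := by fun_prop
        exact this.tendsto.mono_left nhdsWithin_le_nhds
      · filter_upwards [self_mem_nhdsWithin] with z hz h
        exact hz (add_right_cancel h)
    filter_upwards [ev_notMem L c, h2.eventually (ev_notMem L (c + v))] with z hz1 hz2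
    exact extD_diff_off L v z hz1 hz2
  · rw [continuousAt_iff_punctured_nhds, hc0]
    classical
    unfold extD
    exact Tendsto.if' tendsto_const_nhds ht

lemma extD_shift (L : PeriodPair) (v c : ℂ) (l : L.lattice) (h : DifferentiableAt ℂ (extD L v) c) :
    DifferentiableAt ℂ (extD L v) (c + l) := by
  have e : extD L v = fun u ↦ extD L v (u - l) := by
    ext u
    rw [← extD_add L v (u - l) l, sub_add_cancel]
  rw [e]
  have h' : DifferentiableAt ℂ (extD L v) (c + l - l) := by simpa using h
  exact h'.comp (c + l : ℂ) (f := fun u : ℂ ↦ u - l) (by fun_prop)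

lemma extD_diff (L : PeriodPair) (v : ℂ) (hv : v ∉ L.lattice) : Differentiable ℂ (extD L v) := by
  intro u
  by_cases h1 : u ∈ L.lattice
  · have := extD_shift L v 0 ⟨u, h1⟩ (extD_diff_of_tendsto L v 0 (by simp)
      (rawD_tendsto_zero L v hv))
    simpa using this
  by_cases h2 : u + v ∈ L.lattice
  · have := extD_shift L v (-v) ⟨u + v, h2⟩ (extD_diff_of_tendsto L v (-v) (by simp)
      (rawD_tendsto_neg L v hv))
    simpa using this
  exact extD_diff_off L v u h1 h2

lemma extD_eq_zero (L : PeriodPair) (v : ℂ) (hv : v ∉ L.lattice) (u : ℂ) : extD L v u = 0 := by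
  have hd := extD_diff L v hv
  exact (hd.apply_eq_apply_of_bounded (IsZLattice.isCompact_range_of_periodic L.lattice _
    hd.continuous fun z w hw ↦ by lift w to L.lattice using hw; exact extD_add L v z w).isBounded
    u 0).trans (if_pos (by simp))

lemma zetaL_neg (L : PeriodPair) (z : ℂ) : zetaL L (-z) = -zetaL L z := by
  rw [zetaL_eq, zetaL_eq, zetaEx, zetaEx, ← (Equiv.neg L.lattice).tsum_eq, neg_add, ← tsum_neg]
  congr 1
  · rw [div_neg]
  · refine tsum_congr fun l ↦ ?_
    by_cases h : l = 0
    · simp [h]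
    · have h' : l.1 ≠ 0 := by simpa using h
      have e : -z - -l.1 = -(z - l.1) := by ring
      simp only [Equiv.neg_apply, NegMemClass.coe_neg, neg_eq_zero, h', if_false, e, div_neg,
        neg_sq]
      ring

/-- Addition-type identity for Weierstrass functions:
`(℘'(u) + ℘'(u₀)) / (2(℘(u) - ℘(u₀))) = ζ(u - u₀) - ζ(u) + ζ(u₀)`. -/
theorem wp_wzeta_identity (ω₁ ω₂ : ℂ) (hlat : 0 < (ω₂ / ω₁).im) (u₀ u : ℂ)
    (hu₀ : ¬ IsLatticePt ω₁ ω₂ u₀) (h2u₀ : ¬ IsLatticePt ω₁ ω₂ (2 * u₀))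
    (hu : ¬ IsLatticePt ω₁ ω₂ u) (huu₀ : ¬ IsLatticePt ω₁ ω₂ (u - u₀))
    (hne : wp ω₁ ω₂ u ≠ wp ω₁ ω₂ u₀) :
    (deriv (wp ω₁ ω₂) u + deriv (wp ω₁ ω₂) u₀) / (2 * (wp ω₁ ω₂ u - wp ω₁ ω₂ u₀))
      = wzeta ω₁ ω₂ (u - u₀) - wzeta ω₁ ω₂ u + wzeta ω₁ ω₂ u₀ := by
  obtain ⟨L, rfl, rfl⟩ := exists_pair ω₁ ω₂ hlat
  rw [isLatticePt_iff] at hu₀ hu huu₀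
  have hwp : wp L.ω₁ L.ω₂ = L.weierstrassP := funext (wp_eq L)
  have hwz : wzeta L.ω₁ L.ω₂ = zetaL L := funext (wzeta_eq L)
  rw [hwp] at hne ⊢
  rw [hwz, L.deriv_weierstrassP]
  have h0 := extD_eq_zero L (-u₀) (by simpa using hu₀) u
  rw [extD, if_neg (not_or.mpr ⟨hu, by rwa [← sub_eq_add_neg]⟩), rawD, L.weierstrassP_neg,
    L.derivWeierstrassP_neg, zetaL_neg, ← sub_eq_add_neg] at h0
  have h1 : L.weierstrassP u - L.weierstrassP u₀ ≠ 0 := sub_ne_zero.mpr hne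
  rw [div_eq_iff (mul_ne_zero two_ne_zero h1)]
  linear_combination -h0
end

section
/- For the group law on degree-zero linear connections on an elliptic curve: if u₃ = u₁ + u₂ (with u₁, u₂, u₃ ∉ Λ suitably generic), then the tensor product of the connections with parameters (u₁,c₁) and (u₂,c₂) has parameter (u₃, c₃) with c₃ = c₁ + c₂ - (℘'(u₂) - ℘'(u₁))/(2(℘(u₂) - ℘(u₁))); equivalently, the 1-form f₁ + f₂ - f₃ + (c₁+c₂-c₃) is a logarithmic derivative df/f of a meromorphic function f on ℂ/Λ with divisor [u₁]+[u₂]-[u₃]-[0], where f_i(u) = (℘'(u)+℘'(u_i))/(2(℘(u)-℘(u_i))). -/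
open Complex

namespace ConnAux

lemma ev_notMem (L : PeriodPair) : ∀ᶠ z in nhdsWithin (0:ℂ) {0}ᶜ, z ∉ L.lattice ∧ z ≠ 0 := by
  have h := L.compl_lattice_sdiff_singleton_mem_nhds 0
  filter_upwards [mem_nhdsWithin_of_mem_nhds h, self_mem_nhdsWithin] with z hz hz0
  refine ⟨fun hm => hz ⟨hm, hz0⟩, hz0⟩

lemma ev_notMem' (L : PeriodPair) {c : ℂ} (hc : c ∉ L.lattice) :
    ∀ᶠ z in nhds c, z ∉ L.lattice :=
  L.isClosed_lattice.isOpen_compl.mem_nhds hc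

lemma P_zero (L : PeriodPair) (z : ℂ) :
    L.weierstrassP z = L.weierstrassPExcept 0 z + 1 / z ^ 2 := by
  have := L.weierstrassPExcept_add 0 z
  simpa using this.symm

lemma P'_zero (L : PeriodPair) (z : ℂ) :
    L.derivWeierstrassP z = L.derivWeierstrassPExcept 0 z - 2 / z ^ 3 := by
  have := L.derivWeierstrassPExcept_sub 0 z
  simpa using this.symm

lemma hasDerivAt_P (L : PeriodPair) {z : ℂ} (hz : z ∉ L.lattice) :
    HasDerivAt L.weierstrassP (L.derivWeierstrassP z) z := by
  rw [← L.deriv_weierstrassP]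
  exact ((L.analyticOnNhd_weierstrassP z hz).differentiableAt).hasDerivAt

lemma countable_lattice (L : PeriodPair) : (L.lattice : Set ℂ).Countable :=
  Set.countable_coe_iff.1 (Countable.of_equiv _ L.latticeEquivProd.symm.toEquiv)

lemma preconn (s : Set ℂ) (hs : s.Countable) : IsPreconnected sᶜ :=
  (hs.isPathConnected_compl_of_one_lt_rank (by simp)).isConnected.isPreconnected

lemma eq_of_nhdsNE {f g : ℂ → ℂ} {z : ℂ} (hf : ContinuousAt f z) (hg : ContinuousAt g z)
    (h : ∀ᶠ w in nhdsWithin z {z}ᶜ, f w = g w) : f z = g z :=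
  ((hf.eventuallyEq_nhds_iff_eventuallyEq_nhdsNE hg).1 h).eq_of_nhds

lemma hasDerivAt_P' (L : PeriodPair) {z : ℂ} (hz : z ∉ L.lattice) :
    HasDerivAt L.derivWeierstrassP (6 * L.weierstrassP z ^ 2 - L.g₂ / 2) z := by
  have han := L.analyticOnNhd_derivWeierstrassP
  have hd : ∀ w, w ∉ L.lattice →
      HasDerivAt L.derivWeierstrassP (deriv L.derivWeierstrassP w) w :=
    fun w hw => ((han w hw).differentiableAt).hasDerivAt
  suffices h : deriv L.derivWeierstrassP z = 6 * L.weierstrassP z ^ 2 - L.g₂ / 2 by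
    rw [← h]; exact hd z hz
  have hmul : ∀ w, w ∉ L.lattice → L.derivWeierstrassP w *
      (deriv L.derivWeierstrassP w - (6 * L.weierstrassP w ^ 2 - L.g₂ / 2)) = 0 := by
    intro w hw
    have h1 := (hd w hw).pow 2
    have hP := hasDerivAt_P L hw
    have h2 := ((((hP.pow 3).const_mul 4).sub (hP.const_mul L.g₂)).sub_const L.g₃)
    have h3 := h1.unique (h2.congr_of_eventuallyEq (by
      filter_upwards [ev_notMem' L hw] with v hv
      simpa using L.derivWeierstrassP_sq v hv))
    push_cast at h3
    linear_combination h3 / 2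
  rcases (han z hz).eventually_eq_zero_or_eventually_ne_zero with h0 | h0
  · exfalso
    have hz0 := han.eqOn_zero_of_preconnected_of_eventuallyEq_zero
      (preconn _ (countable_lattice L)) hz h0
    have : (0:ℂ) ^ 3 * L.derivWeierstrassPExcept 0 0 = 2 := by
      refine eq_of_nhdsNE (f := fun w => w ^ 3 * L.derivWeierstrassPExcept 0 w)
        (g := fun _ => (2:ℂ)) (z := 0) ?_ continuousAt_const ?_
      · exact (continuousAt_id.pow 3).mul (L.analyticAt_derivWeierstrassPExcept 0).continuousAt
      · filter_upwards [ev_notMem L] with w hw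
        have h1 := hz0 hw.1
        rw [P'_zero] at h1
        have := hw.2
        simp only [Pi.zero_apply] at h1
        field_simp at h1
        linear_combination h1
    norm_num at this
  · refine eq_of_nhdsNE (g := fun z => 6 * L.weierstrassP z ^ 2 - L.g₂ / 2)
      (han z hz).deriv.continuousAt ?_ ?_
    · have := (L.analyticOnNhd_weierstrassP z hz).continuousAt
      fun_prop
    · filter_upwards [h0, mem_nhdsWithin_of_mem_nhds (ev_notMem' L hz)] with w hw hw'
      exact sub_eq_zero.1 ((mul_eq_zero.1 (hmul w hw')).resolve_left hw)

lemma diffQ (K : ℂ) {x₁ x₂ y₁ y₂ : ℂ → ℂ} {z : ℂ} (h1 : DifferentiableAt ℂ x₁ z)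
    (h2 : DifferentiableAt ℂ x₂ z) (h3 : DifferentiableAt ℂ y₁ z) (h4 : DifferentiableAt ℂ y₂ z) :
    DifferentiableAt ℂ (fun z => (y₁ z - y₂ z) ^ 2 -
      4 * (K + x₁ z + x₂ z) * (x₁ z - x₂ z) ^ 2) z := by
  fun_prop

lemma contA {a q : ℂ → ℂ} {z : ℂ} (h1 : ContinuousAt a z) (h2 : ContinuousAt q z) :
    ContinuousAt (fun z => -4 * z * (a z - q z) + z ^ 4 * (a z - q z) ^ 2) z := by
  fun_prop

lemma contB (K : ℂ) {b p : ℂ → ℂ} {z : ℂ} (h1 : ContinuousAt b z) (h2 : ContinuousAt p z) :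
    ContinuousAt (fun z => 4 * ((K + b z + p z) * (1 + z ^ 2 * (b z - p z)) ^ 2
        + 2 * (b z - p z) + z ^ 2 * (b z - p z) ^ 2)) z := by
  fun_prop

lemma add_x (L : PeriodPair) {u v : ℂ} (hu : u ∉ L.lattice) (hv : v ∉ L.lattice)
    (huv : u + v ∉ L.lattice) (hne : L.weierstrassP u ≠ L.weierstrassP v) :
    L.weierstrassP (u + v) =
      ((L.derivWeierstrassP u - L.derivWeierstrassP v) /
        (L.weierstrassP u - L.weierstrassP v)) ^ 2 / 4 - L.weierstrassP u - L.weierstrassP v := by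
  set c := u + v with hc
  have hcu : c - u = v := by rw [hc]; ring
  set x := L.weierstrassP with hx
  set y := L.derivWeierstrassP with hy
  let G : ℂ → ℂ := fun z => ((y z - y (c - z)) / (x z - x (c - z))) ^ 2 / 4 - x z - x (c - z)
  have hGu : G u = ((y u - y v) / (x u - x v)) ^ 2 / 4 - x u - x v := by
    simp only [G, hcu]
  rw [← hGu]
  let K := G u
  -- the good set
  let s : Set ℂ := (L.lattice : Set ℂ) ∪ (fun z => c - z) ⁻¹' (L.lattice : Set ℂ)
  have hs : s.Countable := (countable_lattice L).union
    ((countable_lattice L).preimage (sub_right_injective))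
  have hsP : ∀ z, z ∈ sᶜ ↔ z ∉ L.lattice ∧ c - z ∉ L.lattice := by
    intro z; simp [s]
  have hus : u ∈ sᶜ := (hsP u).2 ⟨hu, by rwa [hcu]⟩
  have hso : IsOpen sᶜ := by
    refine IsClosed.isOpen_compl (self := ?_)
    exact L.isClosed_lattice.union (L.isClosed_lattice.preimage (by fun_prop))
  have dx : ∀ z ∈ sᶜ, HasDerivAt x (y z) z := fun z hz => hasDerivAt_P L ((hsP z).1 hz).1
  have dy : ∀ z ∈ sᶜ, HasDerivAt y (6 * x z ^ 2 - L.g₂ / 2) z :=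
    fun z hz => hasDerivAt_P' L ((hsP z).1 hz).1
  have dx2 : ∀ z ∈ sᶜ, HasDerivAt (fun z => x (c - z)) (-y (c - z)) z := fun z hz => by
    have := (hasDerivAt_P L ((hsP z).1 hz).2).comp_const_sub c z
    exact this
  have dy2 : ∀ z ∈ sᶜ, HasDerivAt (fun z => y (c - z)) (-(6 * x (c - z) ^ 2 - L.g₂ / 2)) z :=
    fun z hz => by
      have := (hasDerivAt_P' L ((hsP z).1 hz).2).comp_const_sub c z
      exact this
  have dG : ∀ z ∈ sᶜ, x z ≠ x (c - z) → HasDerivAt G 0 z := by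
    intro z hz hxz
    have hxz' : x z - x (c - z) ≠ 0 := sub_ne_zero.2 hxz
    have h := ((((((dy z hz).sub (dy2 z hz)).div ((dx z hz).sub (dx2 z hz)) hxz').pow 2).div_const
      4).sub (dx z hz)).sub (dx2 z hz)
    refine h.congr_deriv ?_
    have e1 := L.derivWeierstrassP_sq z ((hsP z).1 hz).1
    have e2 := L.derivWeierstrassP_sq (c - z) ((hsP z).1 hz).2
    rw [← hx, ← hy] at e1 e2
    simp only [Pi.sub_apply, Pi.div_apply]
    generalize x z = a at *
    generalize x (c - z) = b at *
    generalize y z = p at *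
    generalize y (c - z) = q at *
    have hm : ((6 * a ^ 2 - L.g₂ / 2 - -(6 * b ^ 2 - L.g₂ / 2)) * (a - b) - (p - q) * (p - -q)) /
        (a - b) ^ 2 = 2 * (a - b) := by
      rw [div_eq_iff (pow_ne_zero 2 hxz')]
      linear_combination e2 - e1
    rw [hm]
    push_cast
    field_simp
    ring
  have hne' : ∀ᶠ z in nhds u, x z ≠ x (c - z) := by
    have h1 : ContinuousAt (fun z => x z - x (c - z)) u :=
      ((dx u hus).sub (dx2 u hus)).continuousAt
    have h2 := h1.eventually_ne (y := 0) (by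
      simp only [hcu]; exact sub_ne_zero.2 hne)
    filter_upwards [h2] with z hz using sub_ne_zero.1 hz
  have hGK : ∀ᶠ z in nhds u, G z = K := by
    obtain ⟨r, hr, hball⟩ := Metric.eventually_nhds_iff_ball.1 (hne'.and (hso.mem_nhds hus))
    filter_upwards [Metric.ball_mem_nhds u hr] with z hz
    refine (convex_ball u r).is_const_of_fderivWithin_eq_zero (𝕜 := ℂ) (f := G) ?_ ?_ hz
      (Metric.mem_ball_self hr)
    · intro w hw
      exact (dG w (hball w hw).2 (hball w hw).1).differentiableAt.differentiableWithinAt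
    · intro w hw
      rw [fderivWithin_of_isOpen Metric.isOpen_ball hw]
      simpa using (dG w (hball w hw).2 (hball w hw).1).hasFDerivAt.fderiv
  let Q : ℂ → ℂ := fun z => (y z - y (c - z)) ^ 2 -
    4 * (K + x z + x (c - z)) * (x z - x (c - z)) ^ 2
  have hQan : AnalyticOnNhd ℂ Q sᶜ := by
    refine DifferentiableOn.analyticOnNhd (fun z hz => ?_) hso
    exact DifferentiableAt.differentiableWithinAt (diffQ K (dx z hz).differentiableAt
      (dx2 z hz).differentiableAt (dy z hz).differentiableAt (dy2 z hz).differentiableAt)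
  have hQu : Q =ᶠ[nhds u] 0 := by
    filter_upwards [hGK, hne'] with z h1 h2
    have h3 := sub_ne_zero.2 h2
    simp only [Q, ← h1, G, Pi.zero_apply]
    field_simp
    ring
  have hQ0 := hQan.eqOn_zero_of_preconnected_of_eventuallyEq_zero (preconn _ hs) hus hQu
  -- limit at zero
  let b := L.weierstrassPExcept 0
  let a := L.derivWeierstrassPExcept 0
  have hb : ContinuousAt b 0 := (L.analyticAt_weierstrassPExcept 0).continuousAt
  have ha : ContinuousAt a 0 := (L.analyticAt_derivWeierstrassPExcept 0).continuousAt
  have hp : ContinuousAt (fun z => x (c - z)) 0 := by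
    refine ContinuousAt.comp (g := x) ?_ (by fun_prop)
    rw [sub_zero]; exact (hasDerivAt_P L huv).continuousAt
  have hq : ContinuousAt (fun z => y (c - z)) 0 := by
    refine ContinuousAt.comp (g := y) ?_ (by fun_prop)
    rw [sub_zero]; exact (hasDerivAt_P' L huv).continuousAt
  have hfin : (fun z => -4 * z * (a z - y (c - z)) + z ^ 4 * (a z - y (c - z)) ^ 2) 0 =
      (fun z => 4 * ((K + b z + x (c - z)) * (1 + z ^ 2 * (b z - x (c - z))) ^ 2
        + 2 * (b z - x (c - z)) + z ^ 2 * (b z - x (c - z)) ^ 2)) 0 := by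
    refine eq_of_nhdsNE
      (f := fun z => -4 * z * (a z - y (c - z)) + z ^ 4 * (a z - y (c - z)) ^ 2)
      (g := fun z => 4 * ((K + b z + x (c - z)) * (1 + z ^ 2 * (b z - x (c - z))) ^ 2
        + 2 * (b z - x (c - z)) + z ^ 2 * (b z - x (c - z)) ^ 2)) (z := 0) ?_ ?_ ?_
    · exact contA ha hq
    · exact contB K hb hp
    have hcz : ∀ᶠ z in nhds (0:ℂ), c - z ∉ L.lattice := by
      have : Filter.Tendsto (fun z : ℂ => c - z) (nhds 0) (nhds c) := by
        have h : ContinuousAt (fun z : ℂ => c - z) 0 := by fun_prop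
        simpa [ContinuousAt] using h
      exact this.eventually (ev_notMem' L huv)
    filter_upwards [ev_notMem L, mem_nhdsWithin_of_mem_nhds hcz] with z hz hz'
    have h := hQ0 ((hsP z).2 ⟨hz.1, hz'⟩)
    have hz0 := hz.2
    simp only [Q, Pi.zero_apply] at h
    rw [show x z = b z + 1 / z ^ 2 from P_zero L z, show y z = a z - 2 / z ^ 3 from P'_zero L z] at h
    generalize x (c - z) = p at *
    generalize y (c - z) = q at *
    generalize a z = A at *
    generalize b z = B at *
    field_simp at h
    apply mul_left_cancel₀ (pow_ne_zero 2 hz0)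
    linear_combination h
  have hb0 : b 0 = 0 := by simp [b]
  simp only [sub_zero, hb0] at hfin
  change x c = K
  linear_combination hfin / 4

lemma add_y (L : PeriodPair) {u v : ℂ} (hu : u ∉ L.lattice) (hv : v ∉ L.lattice)
    (huv : u + v ∉ L.lattice) (hne : L.weierstrassP u ≠ L.weierstrassP v) :
    L.derivWeierstrassP (u + v) =
      -(L.derivWeierstrassP u + (L.derivWeierstrassP u - L.derivWeierstrassP v) /
        (L.weierstrassP u - L.weierstrassP v) * (L.weierstrassP (u + v) - L.weierstrassP u)) := by
  have hne' : L.weierstrassP u - L.weierstrassP v ≠ 0 := sub_ne_zero.2 hne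
  have dx := hasDerivAt_P L hu
  have dy := hasDerivAt_P' L hu
  have d3 : HasDerivAt (fun z => L.weierstrassP (z + v)) (L.derivWeierstrassP (u + v)) u :=
    (hasDerivAt_P L huv).comp_add_const u v
  have d := (((((dy.sub_const (L.derivWeierstrassP v)).div
    (dx.sub_const (L.weierstrassP v)) hne').pow 2).div_const 4).sub dx).sub_const
      (L.weierstrassP v)
  have hev : ∀ᶠ z in nhds u, z ∉ L.lattice ∧ z + v ∉ L.lattice ∧
      L.weierstrassP z ≠ L.weierstrassP v := by
    refine (ev_notMem' L hu).and (Filter.Eventually.and ?_ (dx.continuousAt.eventually_ne hne))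
    have h : ContinuousAt (fun z : ℂ => z + v) u := by fun_prop
    exact h.eventually (ev_notMem' L huv)
  have h := d3.unique (d.congr_of_eventuallyEq (by
    filter_upwards [hev] with z hz
    simpa using add_x L hz.1 hv hz.2.1 hz.2.2))
  rw [h, add_x L hu hv huv hne]
  have e1 := L.derivWeierstrassP_sq u hu
  have e2 := L.derivWeierstrassP_sq v hv
  simp only [Pi.div_apply]
  generalize L.weierstrassP u = x₁ at *
  generalize L.weierstrassP v = x₂ at *
  generalize L.derivWeierstrassP u = y₁ at *
  generalize L.derivWeierstrassP v = y₂ at *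
  push_cast
  field_simp
  linear_combination (y₁ - y₂) * (e2 - e1)

lemma wp_eq (L : PeriodPair) {w₁ w₂ : ℂ} (h1 : L.ω₁ = w₁) (h2 : L.ω₂ = w₂) :
    wp w₁ w₂ = L.weierstrassP := by
  classical
  funext z
  let g : ℤ × ℤ → ℂ := fun q => 1 / (z - ((q.1 : ℂ) * w₁ + (q.2 : ℂ) * w₂)) ^ 2
      - 1 / ((q.1 : ℂ) * w₁ + (q.2 : ℂ) * w₂) ^ 2
  have hs : HasSum g (L.weierstrassP z) := by
    have h := (L.latticeEquivProd.symm.toEquiv.hasSum_iff).2 (L.hasSum_weierstrassP z)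
    convert h using 1
    funext q
    have := L.latticeEquiv_symm_apply q
    simp only [Function.comp, g, ← h1, ← h2, ← this]
    rfl
  have h3 : ∑' q, g q = g 0 + ∑' q : {q : ℤ × ℤ // q ≠ 0}, g q := by
    have h := hs.summable.sum_add_tsum_subtype_compl {0}
    rw [← h, Finset.sum_singleton]
    congr 1
    let e : {x : ℤ × ℤ // x ∉ ({0} : Finset (ℤ × ℤ))} ≃ {q : ℤ × ℤ // q ≠ 0} :=
      Equiv.subtypeEquivRight (by simp)
    exact e.tsum_eq (fun q : {q : ℤ × ℤ // q ≠ 0} => g q)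
  rw [← hs.tsum_eq, h3]
  simp [wp, g]

lemma indep {w₁ w₂ : ℂ} (h : 0 < (w₂ / w₁).im) : LinearIndependent ℝ ![w₁, w₂] := by
  have h0 : w₁ ≠ 0 := by rintro rfl; simp at h
  rw [LinearIndependent.pair_iff]
  intro s t hst
  have h1 : (s : ℂ) + t * (w₂ / w₁) = 0 := by
    simp only [Complex.real_smul] at hst
    field_simp
    linear_combination hst
  have h2 := congrArg Complex.im h1
  have ht : t = 0 := by
    simp at h2
    rcases h2 with h2 | h2
    · exact h2
    · exact absurd h2 h.ne'
  refine ⟨?_, ht⟩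
  have h3 := congrArg Complex.re h1
  simpa [ht] using h3

lemma final_alg (g x y x₁ y₁ x₂ y₂ x₃ y₃ m k : ℂ)
    (e : y ^ 2 = 4 * x ^ 3 - g * x - k) (e1 : y₁ ^ 2 = 4 * x₁ ^ 3 - g * x₁ - k)
    (e2 : y₂ ^ 2 = 4 * x₂ ^ 3 - g * x₂ - k)
    (hm : y₂ = y₁ + m * (x₂ - x₁)) (h3 : x₃ = m ^ 2 / 4 - x₁ - x₂)
    (hy3 : y₃ = -(y₁ + m * (x₃ - x₁))) (h12 : x₂ - x₁ ≠ 0)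
    (n1 : x - x₁ ≠ 0) (n2 : x - x₂ ≠ 0) (n3 : x - x₃ ≠ 0)
    (hN : y - y₁ - m * (x - x₁) ≠ 0) :
    (6 * x ^ 2 - g / 2 - m * y) / (y - y₁ - m * (x - x₁)) - y / (x - x₃) =
      (y + y₁) / (2 * (x - x₁)) + (y + y₂) / (2 * (x - x₂)) - (y + y₃) / (2 * (x - x₃))
        + m / 2 := by
  have hg : g = 4 * (x₁ ^ 2 + x₁ * x₂ + x₂ ^ 2) - m * (y₁ + y₂) := by
    apply mul_left_cancel₀ h12
    subst hm
    linear_combination e2 - e1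
  have hk : k = 4 * x₁ ^ 3 - g * x₁ - y₁ ^ 2 := by linear_combination e1
  have key : (y - y₁ - m * (x - x₁)) * (y + y₁ + m * (x - x₁)) =
      4 * (x - x₁) * (x - x₂) * (x - x₃) := by
    subst hk hg hm h3
    linear_combination e
  have hN' : y + y₁ + m * (x - x₁) ≠ 0 := by
    intro h0
    rw [h0, mul_zero] at key
    exact (mul_ne_zero (mul_ne_zero (mul_ne_zero (by norm_num) n1) n2) n3) key.symm
  have hinv : (6 * x ^ 2 - g / 2 - m * y) / (y - y₁ - m * (x - x₁)) =
      (6 * x ^ 2 - g / 2 - m * y) * (y + y₁ + m * (x - x₁)) /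
        (4 * (x - x₁) * (x - x₂) * (x - x₃)) := by
    rw [← key]
    field_simp
  rw [hinv]
  field_simp
  subst hy3 hk hg hm h3
  linear_combination (-2 * m) * e

end ConnAux

/-- Group law for degree-zero linear connections on the elliptic curve `ℂ/Λ`:
with `u₃ = u₁ + u₂` and
`c₃ = c₁ + c₂ - (℘'(u₂) - ℘'(u₁))/(2(℘(u₂) - ℘(u₁)))`,
the 1-form `f₁ + f₂ - f₃ + (c₁ + c₂ - c₃)` (where
`f_i(u) = (℘'(u)+℘'(u_i))/(2(℘(u)-℘(u_i)))`) is the logarithmic derivative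
`f'/f` of the elliptic function `f` with divisor `[u₁]+[u₂]-[u₃]-[0]`. -/
theorem connection_group_law (ω₁ ω₂ : ℂ) (hlat : 0 < (ω₂ / ω₁).im)
    (u₁ u₂ u₃ c₁ c₂ c₃ : ℂ)
    (hu₁ : ¬ IsLatticePt ω₁ ω₂ u₁) (hu₂ : ¬ IsLatticePt ω₁ ω₂ u₂)
    (hu₃ : u₃ = u₁ + u₂) (hu₃' : ¬ IsLatticePt ω₁ ω₂ u₃)
    (h12 : wp ω₁ ω₂ u₁ ≠ wp ω₁ ω₂ u₂)
    (hc₃ : c₃ = c₁ + c₂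
      - (deriv (wp ω₁ ω₂) u₂ - deriv (wp ω₁ ω₂) u₁)
        / (2 * (wp ω₁ ω₂ u₂ - wp ω₁ ω₂ u₁)))
    (F₁ F₂ F₃ f : ℂ → ℂ)
    (hF₁ : F₁ = fun u => (deriv (wp ω₁ ω₂) u + deriv (wp ω₁ ω₂) u₁)
        / (2 * (wp ω₁ ω₂ u - wp ω₁ ω₂ u₁)))
    (hF₂ : F₂ = fun u => (deriv (wp ω₁ ω₂) u + deriv (wp ω₁ ω₂) u₂)
        / (2 * (wp ω₁ ω₂ u - wp ω₁ ω₂ u₂)))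
    (hF₃ : F₃ = fun u => (deriv (wp ω₁ ω₂) u + deriv (wp ω₁ ω₂) u₃)
        / (2 * (wp ω₁ ω₂ u - wp ω₁ ω₂ u₃)))
    (hf : f = fun u =>
      (deriv (wp ω₁ ω₂) u - deriv (wp ω₁ ω₂) u₁
        - (deriv (wp ω₁ ω₂) u₂ - deriv (wp ω₁ ω₂) u₁)
            / (wp ω₁ ω₂ u₂ - wp ω₁ ω₂ u₁) * (wp ω₁ ω₂ u - wp ω₁ ω₂ u₁))
        / (wp ω₁ ω₂ u - wp ω₁ ω₂ u₃)) :
    ∀ u : ℂ, ¬ IsLatticePt ω₁ ω₂ u →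
      wp ω₁ ω₂ u ≠ wp ω₁ ω₂ u₁ → wp ω₁ ω₂ u ≠ wp ω₁ ω₂ u₂ →
      wp ω₁ ω₂ u ≠ wp ω₁ ω₂ u₃ → f u ≠ 0 →
      deriv f u / f u = F₁ u + F₂ u - F₃ u + c₁ + c₂ - c₃ := by
  intro u hu n1 n2 n3 hfu
  obtain ⟨L, hL1, hL2⟩ : ∃ L : PeriodPair, L.ω₁ = ω₁ ∧ L.ω₂ = ω₂ :=
    ⟨⟨ω₁, ω₂, ConnAux.indep hlat⟩, rfl, rfl⟩
  have hmem : ∀ z, ¬ IsLatticePt ω₁ ω₂ z → z ∉ L.lattice := by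
    intro z hz hm
    obtain ⟨m, n, h⟩ := PeriodPair.mem_lattice.1 hm
    exact hz ⟨m, n, by rw [← h, hL1, hL2]⟩
  have hw := ConnAux.wp_eq L hL1 hL2
  simp only [hw, L.deriv_weierstrassP] at h12 hc₃ hF₁ hF₂ hF₃ hf n1 n2 n3
  have mu := hmem u hu
  have m1 := hmem u₁ hu₁
  have m2 := hmem u₂ hu₂
  have m3 := hmem u₃ hu₃'
  have h21 : L.weierstrassP u₂ - L.weierstrassP u₁ ≠ 0 := sub_ne_zero.2 h12.symm
  have hx3 := ConnAux.add_x L m1 m2 (hu₃ ▸ m3) h12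
  have hy3 := ConnAux.add_y L m1 m2 (hu₃ ▸ m3) h12
  rw [← hu₃] at hx3 hy3
  have hmm : (L.derivWeierstrassP u₁ - L.derivWeierstrassP u₂) /
      (L.weierstrassP u₁ - L.weierstrassP u₂) = (L.derivWeierstrassP u₂ - L.derivWeierstrassP u₁) /
      (L.weierstrassP u₂ - L.weierstrassP u₁) := by
    rw [← neg_sub, ← neg_sub (L.weierstrassP u₂), neg_div_neg_eq]
  rw [hmm] at hx3 hy3
  have hcc : c₁ + c₂ - c₃ = (L.derivWeierstrassP u₂ - L.derivWeierstrassP u₁) /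
      (L.weierstrassP u₂ - L.weierstrassP u₁) / 2 := by
    rw [hc₃, div_div, mul_comm 2]; ring
  have hmy : L.derivWeierstrassP u₂ = L.derivWeierstrassP u₁ +
      (L.derivWeierstrassP u₂ - L.derivWeierstrassP u₁) /
      (L.weierstrassP u₂ - L.weierstrassP u₁) * (L.weierstrassP u₂ - L.weierstrassP u₁) := by
    rw [div_mul_cancel₀ _ h21]; ring
  set m := (L.derivWeierstrassP u₂ - L.derivWeierstrassP u₁) /
      (L.weierstrassP u₂ - L.weierstrassP u₁) with hm
  have k1 := sub_ne_zero.2 n1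
  have k2 := sub_ne_zero.2 n2
  have k3 := sub_ne_zero.2 n3
  have hN : L.derivWeierstrassP u - L.derivWeierstrassP u₁ -
      m * (L.weierstrassP u - L.weierstrassP u₁) ≠ 0 := by
    intro h0
    apply hfu
    rw [hf]
    simp only [h0, zero_div]
  have dx := ConnAux.hasDerivAt_P L mu
  have dy := ConnAux.hasDerivAt_P' L mu
  have d := ((dy.sub_const (L.derivWeierstrassP u₁)).sub
      ((dx.sub_const (L.weierstrassP u₁)).const_mul m)).div
        (dx.sub_const (L.weierstrassP u₃)) k3
  have hd := d.congr_of_eventuallyEq (f₁ := f) (Filter.Eventually.of_forall (by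
    intro z; rw [hf]; rfl))
  have key := ConnAux.final_alg L.g₂ (L.weierstrassP u) (L.derivWeierstrassP u)
    (L.weierstrassP u₁) (L.derivWeierstrassP u₁) (L.weierstrassP u₂) (L.derivWeierstrassP u₂)
    (L.weierstrassP u₃) (L.derivWeierstrassP u₃) m L.g₃
    (L.derivWeierstrassP_sq u mu) (L.derivWeierstrassP_sq u₁ m1) (L.derivWeierstrassP_sq u₂ m2)
    hmy hx3 hy3 h21 k1 k2 k3 hN
  have hR : F₁ u + F₂ u - F₃ u + c₁ + c₂ - c₃ = F₁ u + F₂ u - F₃ u + m / 2 := by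
    rw [← hcc]; ring
  rw [hR, hd.deriv, hf, hF₁, hF₂, hF₃]
  simp only []
  rw [← key]
  simp only [Pi.sub_apply]
  field_simp
end
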